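/- Let Ĥ be a symmetric n×n real matrix and G an m×n real matrix such that: (i) xᵀĤx ≥ γ_H‖x‖² for all x with Gx = 0; (ii) GGᵀ ⪰ γ_G I; (iii) ‖Ĥ‖ ≤ Υ and ‖G‖ ≤ Υ, where Υ ≥ 1 ≥ γ_H, γ_H > 0, and 0 < γ_G ≤ 1. Let μ ≥ 4Υ²/(γ_G γ_H). Let W be a subset of the column indices {1,…,n}, and let the row indices {1,…,m} be partitioned into three disjoint sets S₁, S₂, S₃ such that the submatrix G[S₃][W] (rows in S₃, columns in W) is the zero matrix. Then for every vector w ∈ ℝ^W with G[S₁][W]·w = 0, one has wᵀ( Ĥ[W][W] + μ·(G[S₂][W])ᵀ G[S₂][W] ) w ≥ (γ_H/2)‖w‖². -/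

import Mathlib

open Matrix

/-- The spectral (ℓ²-operator) norm of a real matrix. -/
noncomputable def specNorm {α β : Type*} [Fintype α] [Fintype β] [DecidableEq β]
    (A : Matrix α β ℝ) : ℝ :=
  ‖LinearMap.toContinuousLinearMap (Matrix.toEuclideanLin A)‖

/-- The submatrix `A[S][W]` of `A` with rows in `S` and columns in `W`. -/
def subMat {α β : Type*} (A : Matrix α β ℝ) (S : Finset α) (W : Finset β) :
    Matrix {i // i ∈ S} {j // j ∈ W} ℝ :=
  A.submatrix (fun i : {i // i ∈ S} => (i : α)) (fun j : {j // j ∈ W} => (j : β))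

/-- Extension by zero of a vector indexed by a finite set. -/
def zeroExtend {β : Type*} [DecidableEq β] {W : Finset β} (w : {j // j ∈ W} → ℝ) (j : β) : ℝ :=
  if h : j ∈ W then w ⟨j, h⟩ else 0

lemma dotProduct_zeroExtend {β : Type*} [Fintype β] [DecidableEq β] {W : Finset β}
    (f : β → ℝ) (w : {j // j ∈ W} → ℝ) :
    f ⬝ᵥ zeroExtend w = (fun j : {j // j ∈ W} => f j) ⬝ᵥ w := by
  have h1 : ∑ j ∈ W, f j * zeroExtend w j = ∑ j, f j * zeroExtend w j := by
    refine Finset.sum_subset (Finset.subset_univ W) fun j _ hj => ?_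
    simp [zeroExtend, hj]
  simp only [dotProduct]
  rw [← h1, ← Finset.sum_coe_sort]
  refine Finset.sum_congr rfl fun j _ => ?_
  simp [zeroExtend]

lemma zeroExtend_dotProduct_self {β : Type*} [Fintype β] [DecidableEq β] {W : Finset β}
    (w : {j // j ∈ W} → ℝ) : zeroExtend w ⬝ᵥ zeroExtend w = w ⬝ᵥ w := by
  rw [dotProduct_zeroExtend]
  congr 1
  ext j
  simp [zeroExtend]

lemma subMat_mulVec {α β : Type*} [Fintype β] [DecidableEq β]
    (A : Matrix α β ℝ) (S : Finset α) (W : Finset β) (w : {j // j ∈ W} → ℝ) (i : {i // i ∈ S}) :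
    (subMat A S W).mulVec w i = A.mulVec (zeroExtend w) i :=
  (dotProduct_zeroExtend (A i) w).symm

lemma dotProduct_self_nonneg_real {α : Type*} [Fintype α] (v : α → ℝ) : 0 ≤ v ⬝ᵥ v :=
  Finset.sum_nonneg fun i _ => mul_self_nonneg (v i)

lemma EuclideanSpace.norm_toLp_sq_eq_dotProduct {α : Type*} [Fintype α] (v : α → ℝ) :
    ‖WithLp.toLp 2 v‖ ^ 2 = v ⬝ᵥ v := by
  rw [EuclideanSpace.real_norm_sq_eq]
  simp [dotProduct, sq]

lemma mulVec_dotProduct_self_le_of_specNorm_le {α β : Type*} [Fintype α] [Fintype β]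
    [DecidableEq β] {A : Matrix α β ℝ} {c : ℝ} (hA : specNorm A ≤ c) (v : β → ℝ) :
    A.mulVec v ⬝ᵥ A.mulVec v ≤ c ^ 2 * (v ⬝ᵥ v) := by
  rw [← EuclideanSpace.norm_toLp_sq_eq_dotProduct, ← EuclideanSpace.norm_toLp_sq_eq_dotProduct,
    ← mul_pow]
  have h := ContinuousLinearMap.le_of_opNorm_le
    (LinearMap.toContinuousLinearMap (Matrix.toEuclideanLin A)) hA (WithLp.toLp 2 v)
  simp only [LinearMap.coe_toContinuousLinearMap', Matrix.toLpLin_toLp] at h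
  exact pow_le_pow_left₀ (norm_nonneg _) h 2

/-- Young's inequality for the dot product. -/
lemma neg_le_two_mul_dotProduct {α : Type*} [Fintype α] (u v : α → ℝ) {t : ℝ} (ht : 0 < t) :
    -(t * (u ⬝ᵥ u) + t⁻¹ * (v ⬝ᵥ v)) ≤ 2 * (u ⬝ᵥ v) := by
  have h := dotProduct_self_nonneg_real (t • u + v)
  simp only [add_dotProduct, dotProduct_add, smul_dotProduct, dotProduct_smul, smul_eq_mul,
    dotProduct_comm v u] at h
  have h2 := mul_nonneg (inv_nonneg.mpr ht.le) h
  have h3 : t⁻¹ * (t * (t * (u ⬝ᵥ u)) + t * (u ⬝ᵥ v) + (t * (u ⬝ᵥ v) + v ⬝ᵥ v))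
      = t * (u ⬝ᵥ u) + 2 * (u ⬝ᵥ v) + t⁻¹ * (v ⬝ᵥ v) := by
    field_simp
    ring
  linarith

lemma dotProduct_mulVec_transpose_mul_self {α β : Type*} [Fintype α] [Fintype β]
    (A : Matrix α β ℝ) (v : β → ℝ) : v ⬝ᵥ (Aᵀ * A).mulVec v = A.mulVec v ⬝ᵥ A.mulVec v := by
  rw [← mulVec_mulVec, dotProduct_mulVec, vecMul_transpose]

/-- If `A Aᵀ ⪰ γ I`, then every vector is the sum of a null vector `u` of `A` and a vector `v`
orthogonal to `u` on which `A` is bounded below. -/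
lemma exists_null_add_orthogonal {α β : Type*} [Fintype α] [Fintype β] [DecidableEq α]
    {A : Matrix α β ℝ} {γ : ℝ} (hγ : 0 < γ)
    (hA : ∀ y : α → ℝ, γ * (y ⬝ᵥ y) ≤ y ⬝ᵥ (A * Aᵀ).mulVec y) (x : β → ℝ) :
    ∃ u v : β → ℝ, x = u + v ∧ A.mulVec u = 0 ∧ u ⬝ᵥ v = 0 ∧
      γ * (v ⬝ᵥ v) ≤ A.mulVec x ⬝ᵥ A.mulVec x := by
  have hinj : Function.Injective (A * Aᵀ).mulVecLin := by
    rw [injective_iff_map_eq_zero]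
    intro y hy
    rw [mulVecLin_apply] at hy
    have h := hA y
    rw [hy, dotProduct_zero] at h
    have h0 := dotProduct_self_nonneg_real y
    exact dotProduct_self_eq_zero.mp (by nlinarith)
  obtain ⟨y, hy⟩ := LinearMap.surjective_of_injective hinj (A.mulVec x)
  rw [mulVecLin_apply] at hy
  have hAv : A.mulVec (Aᵀ.mulVec y) = A.mulVec x := by rw [mulVec_mulVec, hy]
  have hu : A.mulVec (x - Aᵀ.mulVec y) = 0 := by rw [mulVec_sub, hAv, sub_self]
  refine ⟨x - Aᵀ.mulVec y, Aᵀ.mulVec y, by simp, hu, ?_, ?_⟩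
  · rw [dotProduct_mulVec, vecMul_transpose, hu, zero_dotProduct]
  · have hv : Aᵀ.mulVec y ⬝ᵥ Aᵀ.mulVec y = y ⬝ᵥ A.mulVec x := by
      rw [dotProduct_mulVec, vecMul_transpose, hAv, dotProduct_comm]
    have h1 := hA y
    rw [hy] at h1
    have h2 := neg_le_two_mul_dotProduct (-y) (A.mulVec x) hγ
    simp only [neg_dotProduct, dotProduct_neg, neg_neg] at h2
    have h3 : y ⬝ᵥ A.mulVec x ≤ γ⁻¹ * (A.mulVec x ⬝ᵥ A.mulVec x) := by linarith
    rw [hv]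
    calc γ * (y ⬝ᵥ A.mulVec x) ≤ γ * (γ⁻¹ * (A.mulVec x ⬝ᵥ A.mulVec x)) := by gcongr
      _ = _ := by rw [mul_inv_cancel_left₀ hγ.ne']

/-- Positive definiteness of the augmented Hessian `H + μ Gᵀ G` for large `μ`. -/
lemma augmented_hessian_posdef {α β : Type*} [Fintype α] [Fintype β] [DecidableEq α]
    [DecidableEq β] {γH γG Υ μ : ℝ} (hγH : 0 < γH) (hγH1 : γH ≤ 1) (hγG : 0 < γG) (hΥ : 1 ≤ Υ)
    {H : Matrix β β ℝ} {G : Matrix α β ℝ} (hsymm : H.IsSymm)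
    (hred : ∀ x : β → ℝ, G.mulVec x = 0 → γH * (x ⬝ᵥ x) ≤ x ⬝ᵥ H.mulVec x)
    (hGG : ∀ y : α → ℝ, γG * (y ⬝ᵥ y) ≤ y ⬝ᵥ (G * Gᵀ).mulVec y)
    (hH : specNorm H ≤ Υ) (hμ : 4 * Υ ^ 2 / (γG * γH) ≤ μ) (x : β → ℝ) :
    (γH / 2) * (x ⬝ᵥ x) ≤ x ⬝ᵥ H.mulVec x + μ * (G.mulVec x ⬝ᵥ G.mulVec x) := by
  obtain ⟨u, v, rfl, hu, huv, hv⟩ := exists_null_add_orthogonal hγG hGG x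
  have hΥ0 : 0 < Υ := by linarith
  have hHv := mulVec_dotProduct_self_le_of_specNorm_le hH v
  have hsw : v ⬝ᵥ H.mulVec u = u ⬝ᵥ H.mulVec v := by
    rw [dotProduct_mulVec, ← mulVec_transpose, hsymm.eq, dotProduct_comm]
  have hV := dotProduct_self_nonneg_real v
  have hru := hred u hu
  have hcross : -(γH / 2 * (u ⬝ᵥ u) + 2 * (Υ ^ 2 / γH * (v ⬝ᵥ v))) ≤ 2 * (u ⬝ᵥ H.mulVec v) := by
    have h1 := neg_le_two_mul_dotProduct u (H.mulVec v) (half_pos hγH)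
    have h2 := mul_le_mul_of_nonneg_left hHv (inv_nonneg.mpr (half_pos hγH).le)
    have h3 : (γH / 2)⁻¹ * (Υ ^ 2 * (v ⬝ᵥ v)) = 2 * (Υ ^ 2 / γH * (v ⬝ᵥ v)) := by
      field_simp
    linarith
  have hdiag : -(Υ * (v ⬝ᵥ v)) ≤ v ⬝ᵥ H.mulVec v := by
    have h1 := neg_le_two_mul_dotProduct v (H.mulVec v) hΥ0
    have h2 := mul_le_mul_of_nonneg_left hHv (inv_nonneg.mpr hΥ0.le)
    have h3 : Υ⁻¹ * (Υ ^ 2 * (v ⬝ᵥ v)) = Υ * (v ⬝ᵥ v) := by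
      field_simp
    linarith
  have hpen : 4 * (Υ ^ 2 / γH * (v ⬝ᵥ v)) ≤ μ * (G.mulVec (u + v) ⬝ᵥ G.mulVec (u + v)) := by
    calc 4 * (Υ ^ 2 / γH * (v ⬝ᵥ v)) = 4 * Υ ^ 2 / (γG * γH) * (γG * (v ⬝ᵥ v)) := by
          field_simp
      _ ≤ μ * (G.mulVec (u + v) ⬝ᵥ G.mulVec (u + v)) :=
          mul_le_mul hμ hv (by positivity) (le_trans (by positivity) hμ)
  have hcoef : Υ + γH / 2 ≤ 2 * (Υ ^ 2 / γH) := by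
    have h1 : Υ ^ 2 ≤ Υ ^ 2 / γH := le_div_self (by positivity) hγH hγH1
    nlinarith
  have hcoefv := mul_le_mul_of_nonneg_right hcoef hV
  have hsq : (u + v) ⬝ᵥ (u + v) = u ⬝ᵥ u + v ⬝ᵥ v := by
    simp only [add_dotProduct, dotProduct_add, dotProduct_comm v u, huv]
    ring
  have hquad : (u + v) ⬝ᵥ H.mulVec (u + v)
      = u ⬝ᵥ H.mulVec u + 2 * (u ⬝ᵥ H.mulVec v) + v ⬝ᵥ H.mulVec v := by
    simp only [mulVec_add, add_dotProduct, dotProduct_add, hsw]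
    ring
  rw [hsq, hquad]
  linarith

/-- reduced positive definiteness of the subproblem Hessian
`Ĥ[W][W] + μ (G[S₂][W])ᵀ G[S₂][W]` on the null space of `G[S₁][W]`. -/
theorem subproblem_hessian_posdef (n m : ℕ) (γH γG Υ μ : ℝ)
    (hγH : 0 < γH) (hγH1 : γH ≤ 1) (hγG : 0 < γG) (hγG1 : γG ≤ 1) (hΥ : 1 ≤ Υ)
    (Hh : Matrix (Fin n) (Fin n) ℝ) (G : Matrix (Fin m) (Fin n) ℝ)
    (hsymm : Hh.IsSymm)
    (hred : ∀ x : Fin n → ℝ, G.mulVec x = 0 → γH * (x ⬝ᵥ x) ≤ x ⬝ᵥ Hh.mulVec x)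
    (hGG : ∀ y : Fin m → ℝ, γG * (y ⬝ᵥ y) ≤ y ⬝ᵥ (G * Gᵀ).mulVec y)
    (hHn : specNorm Hh ≤ Υ) (hGn : specNorm G ≤ Υ)
    (hμ : 4 * Υ ^ 2 / (γG * γH) ≤ μ)
    (W : Finset (Fin n)) (S₁ S₂ S₃ : Finset (Fin m))
    (h12 : Disjoint S₁ S₂) (h13 : Disjoint S₁ S₃) (h23 : Disjoint S₂ S₃)
    (hcover : S₁ ∪ S₂ ∪ S₃ = Finset.univ)
    (hzero : ∀ i ∈ S₃, ∀ j ∈ W, G i j = 0) :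
    ∀ w : {j // j ∈ W} → ℝ, (subMat G S₁ W).mulVec w = 0 →
      (γH / 2) * (w ⬝ᵥ w) ≤
        w ⬝ᵥ (subMat Hh W W + μ • ((subMat G S₂ W)ᵀ * subMat G S₂ W)).mulVec w := by
  intro w hw
  have hG1 : ∀ i ∈ S₁, G.mulVec (zeroExtend w) i = 0 := fun i hi => by
    rw [← subMat_mulVec G S₁ W w ⟨i, hi⟩, hw, Pi.zero_apply]
  have hG3 : ∀ i ∈ S₃, G.mulVec (zeroExtend w) i = 0 := fun i hi => by
    rw [mulVec, dotProduct]
    refine Finset.sum_eq_zero fun j _ => ?_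
    by_cases hj : j ∈ W
    · simp [hzero i hi j hj]
    · simp [zeroExtend, hj]
  have hpen : (subMat G S₂ W).mulVec w ⬝ᵥ (subMat G S₂ W).mulVec w
      = G.mulVec (zeroExtend w) ⬝ᵥ G.mulVec (zeroExtend w) := by
    simp only [dotProduct, subMat_mulVec]
    rw [Finset.sum_coe_sort S₂
      (fun i => G.mulVec (zeroExtend w) i * G.mulVec (zeroExtend w) i)]
    refine Finset.sum_subset (Finset.subset_univ S₂) fun i _ hi => ?_
    have hmem : i ∈ S₁ ∪ S₂ ∪ S₃ := hcover ▸ Finset.mem_univ i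
    simp only [Finset.mem_union] at hmem
    rcases hmem with (h | h) | h
    · simp [hG1 i h]
    · exact absurd h hi
    · simp [hG3 i h]
  have hquad : w ⬝ᵥ (subMat Hh W W).mulVec w
      = zeroExtend w ⬝ᵥ Hh.mulVec (zeroExtend w) := by
    rw [dotProduct_comm, dotProduct_comm (zeroExtend w), dotProduct_zeroExtend]
    congr 1
    ext i
    exact subMat_mulVec Hh W W w i
  rw [add_mulVec, dotProduct_add, smul_mulVec, dotProduct_smul, smul_eq_mul,
    dotProduct_mulVec_transpose_mul_self, hpen, hquad, ← zeroExtend_dotProduct_self w]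
  exact augmented_hessian_posdef hγH hγH1 hγG hΥ hsymm hred hGG hHn hμ (zeroExtend w)
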